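/- Lipschitz estimate at the flat boundary: Let γ < 1 and f ∈ C(Q₁⁺) ∩ L^∞(Q₁⁺). Assume u ∈ C(closure Q₁⁺) belongs to S*(λ,Λ,f) in Q₁⁺ and u = 0 on ∂_p Q₁⁺ ∩ {x_n = 0}. Then |u(x,t)| ≤ C(‖u‖_{L^∞(Q₁⁺)} + ‖f‖_{L^∞(Q₁⁺)})|x| for all (x,t) ∈ closure Q_{1/2}⁺, where C > 0 depends only on n, λ, Λ, and γ. -/

import Mathlib

noncomputable section

open Real Topology Filter Set MeasureTheory

namespace DPP

/-- Space-time points. -/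
abbrev Pt (n : ℕ) := (Fin n → ℝ) × ℝ

/-- The last index of `Fin n`. -/
def lastIdx (n : ℕ) [NeZero n] : Fin n :=
  ⟨n - 1, Nat.sub_lt (Nat.pos_of_ne_zero (NeZero.ne n)) one_pos⟩

/-- The last spatial coordinate `x_n`. -/
def xlast {n : ℕ} [NeZero n] (x : Fin n → ℝ) : ℝ := x (lastIdx n)

/-- Euclidean norm on `Fin n → ℝ`. -/
def eucNorm {n : ℕ} (x : Fin n → ℝ) : ℝ := Real.sqrt (∑ i, (x i) ^ 2)

/-- Euclidean norm of the first `n-1` coordinates (the `x'` part). -/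
def eucNormPrime {n : ℕ} [NeZero n] (x : Fin n → ℝ) : ℝ :=
  Real.sqrt (∑ i, if i = lastIdx n then 0 else (x i) ^ 2)

/-- Frobenius norm of a matrix. -/
def matNorm {n : ℕ} (M : Matrix (Fin n) (Fin n) ℝ) : ℝ :=
  Real.sqrt (∑ i, ∑ j, (M i j) ^ 2)

/-- The intrinsic parabolic quasidistance `|x-y| + |t-s|^(1/(2-γ))`. -/
def pdist {n : ℕ} (γ : ℝ) (p q : Pt n) : ℝ :=
  eucNorm (p.1 - q.1) + |p.2 - q.2| ^ ((1 : ℝ) / (2 - γ))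

/-- The intrinsic cylinder `Q_r(x₀,t₀)`. -/
def Qcyl {n : ℕ} (γ r : ℝ) (x₀ : Fin n → ℝ) (t₀ : ℝ) : Set (Pt n) :=
  {p | eucNorm (p.1 - x₀) < r ∧ t₀ - r ^ (2 - γ) < p.2 ∧ p.2 ≤ t₀}

/-- The upper intrinsic cylinder `Q_r⁺(x₀,t₀)`. -/
def Qp {n : ℕ} [NeZero n] (γ r : ℝ) (x₀ : Fin n → ℝ) (t₀ : ℝ) : Set (Pt n) :=
  {p ∈ Qcyl γ r x₀ t₀ | 0 < xlast p.1}

/-- `Q₁⁺`. -/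
def Q1p (n : ℕ) [NeZero n] (γ : ℝ) : Set (Pt n) := Qp γ 1 (0 : Fin n → ℝ) 0

/-- The parabolic boundary of `Q₁⁺`. -/
def pbQ1p (n : ℕ) [NeZero n] (γ : ℝ) : Set (Pt n) := closure (Q1p n γ) \ Q1p n γ

/-- The flat part `∂_p Q₁⁺ ∩ {x_n = 0}`. -/
def flatQ1p (n : ℕ) [NeZero n] (γ : ℝ) : Set (Pt n) :=
  {p ∈ pbQ1p n γ | xlast p.1 = 0}

/-- Symmetric matrices `A` with `λ I ≤ A ≤ Λ I`. -/
def ellipticMats (n : ℕ) (lam Lam : ℝ) : Set (Matrix (Fin n) (Fin n) ℝ) :=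
  {A | A.IsSymm ∧ ∀ v : Fin n → ℝ,
    lam * ∑ i, (v i) ^ 2 ≤ ∑ i, ∑ j, A i j * v i * v j ∧
    ∑ i, ∑ j, A i j * v i * v j ≤ Lam * ∑ i, (v i) ^ 2}

/-- Pucci maximal operator `𝓜⁺`. -/
def pucciPlus {n : ℕ} (lam Lam : ℝ) (M : Matrix (Fin n) (Fin n) ℝ) : ℝ :=
  sSup ((fun A => (A * M).trace) '' ellipticMats n lam Lam)

/-- Pucci minimal operator `𝓜⁻`. -/
def pucciMinus {n : ℕ} (lam Lam : ℝ) (M : Matrix (Fin n) (Fin n) ℝ) : ℝ :=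
  sInf ((fun A => (A * M).trace) '' ellipticMats n lam Lam)

/-- A test function: continuous, `C¹` in time and `C²` in space. -/
def IsTestFn {n : ℕ} (φ : Pt n → ℝ) : Prop :=
  Continuous φ ∧ (∀ x : Fin n → ℝ, ContDiff ℝ 1 fun t => φ (x, t)) ∧
    ∀ t : ℝ, ContDiff ℝ 2 fun x => φ (x, t)

/-- The time derivative of `φ` at `p`. -/
def timeD {n : ℕ} (φ : Pt n → ℝ) (p : Pt n) : ℝ := deriv (fun s => φ (p.1, s)) p.2

/-- The spatial gradient of `φ` at `p`. -/
def spaceGrad {n : ℕ} (φ : Pt n → ℝ) (p : Pt n) : Fin n → ℝ :=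
  fun i => fderiv ℝ (fun x => φ (x, p.2)) p.1 (Pi.single i 1)

/-- The spatial Hessian of `φ` at `p`. -/
def hess {n : ℕ} (φ : Pt n → ℝ) (p : Pt n) : Matrix (Fin n) (Fin n) ℝ :=
  fun i j =>
    fderiv ℝ (fun x => fderiv ℝ (fun y => φ (y, p.2)) x (Pi.single j 1)) p.1 (Pi.single i 1)

/-- `φ` touches `u` from above at `p` within `Ω`. -/
def TouchAbove {n : ℕ} (u φ : Pt n → ℝ) (Ω : Set (Pt n)) (p : Pt n) : Prop :=
  u p = φ p ∧ ∀ᶠ q in 𝓝[Ω] p, u q ≤ φ q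

/-- `φ` touches `u` from below at `p` within `Ω`. -/
def TouchBelow {n : ℕ} (u φ : Pt n → ℝ) (Ω : Set (Pt n)) (p : Pt n) : Prop :=
  u p = φ p ∧ ∀ᶠ q in 𝓝[Ω] p, φ q ≤ u q

/-- Viscosity subsolution of `u_t - x_n^γ F(D²u, x, t) = f` in `Ω`. -/
def ViscSub {n : ℕ} [NeZero n] (γ : ℝ) (F : Matrix (Fin n) (Fin n) ℝ → Pt n → ℝ)
    (f u : Pt n → ℝ) (Ω : Set (Pt n)) : Prop :=
  ∀ p ∈ Ω, ∀ φ : Pt n → ℝ, IsTestFn φ → TouchAbove u φ Ω p →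
    timeD φ p - xlast p.1 ^ γ * F (hess φ p) p ≤ f p

/-- Viscosity supersolution of `u_t - x_n^γ F(D²u, x, t) = f` in `Ω`. -/
def ViscSuper {n : ℕ} [NeZero n] (γ : ℝ) (F : Matrix (Fin n) (Fin n) ℝ → Pt n → ℝ)
    (f u : Pt n → ℝ) (Ω : Set (Pt n)) : Prop :=
  ∀ p ∈ Ω, ∀ φ : Pt n → ℝ, IsTestFn φ → TouchBelow u φ Ω p →
    f p ≤ timeD φ p - xlast p.1 ^ γ * F (hess φ p) p

/-- The sup norm of `u` over `S`. -/
def supAbs {n : ℕ} (u : Pt n → ℝ) (S : Set (Pt n)) : ℝ := ⨆ p : S, |u ↑p|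

/-- The solution class `S*(λ,Λ,f)` in `Ω`. -/
def InSstar {n : ℕ} [NeZero n] (γ lam Lam : ℝ) (f u : Pt n → ℝ) (Ω : Set (Pt n)) : Prop :=
  ViscSub γ (fun M _ => pucciPlus lam Lam M) (fun _ => supAbs f Ω) u Ω ∧
  ViscSuper γ (fun M _ => pucciMinus lam Lam M) (fun _ => -supAbs f Ω) u Ω

/-- The solution class `S(λ,Λ,0)` in `Ω`. -/
def InS0 {n : ℕ} [NeZero n] (γ lam Lam : ℝ) (u : Pt n → ℝ) (Ω : Set (Pt n)) : Prop :=
  ViscSub γ (fun M _ => pucciPlus lam Lam M) (fun _ => 0) u Ω ∧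
  ViscSuper γ (fun M _ => pucciMinus lam Lam M) (fun _ => 0) u Ω

/-- The boundary `C^{1,ᾱ}` estimate for the homogeneous model problem, with constants
`abar` and `C₁`. -/
def ModelEstimate (n : ℕ) [NeZero n] (γ lam Lam abar C₁ : ℝ) : Prop :=
  ∀ u : Pt n → ℝ, ContinuousOn u (closure (Q1p n γ)) →
    InS0 γ lam Lam u (Q1p n γ) →
    (∀ p ∈ flatQ1p n γ, u p = 0) →
    supAbs u (Q1p n γ) ≤ 1 →
    ∃ a : ℝ, |a| ≤ C₁ ∧ ∀ p ∈ closure (Qp γ (1/2) (0 : Fin n → ℝ) 0),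
      |u p - a * xlast p.1| ≤
        C₁ * (eucNorm p.1 + |p.2| ^ ((1 : ℝ) / (2 - γ))) ^ abar * xlast p.1

/-- Structure condition (F1): uniform parabolicity. -/
def UnifParab (n : ℕ) (lam Lam : ℝ) (F : Matrix (Fin n) (Fin n) ℝ → Pt n → ℝ) : Prop :=
  ∀ M N : Matrix (Fin n) (Fin n) ℝ, M.IsSymm → N.IsSymm → ∀ p : Pt n,
    pucciMinus lam Lam (M - N) ≤ F M p - F N p ∧ F M p - F N p ≤ pucciPlus lam Lam (M - N)

/-- Structure condition (F2): `F` is concave or convex in the matrix variable. -/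
def ConcaveOrConvex (n : ℕ) (F : Matrix (Fin n) (Fin n) ℝ → Pt n → ℝ) : Prop :=
  (∀ p : Pt n, ConvexOn ℝ Set.univ fun M => F M p) ∨
  (∀ p : Pt n, ConcaveOn ℝ Set.univ fun M => F M p)

/-- The Hessian matrix of the quadratic polynomial `P(x) = ∑ i, a i * x i * x n`. -/
def quadMat (n : ℕ) [NeZero n] (a : Fin n → ℝ) : Matrix (Fin n) (Fin n) ℝ :=
  fun i j => (if j = lastIdx n then a i else 0) + (if i = lastIdx n then a j else 0)

/-- The parabolic boundary of a general set `S ⊆ ℝ^{n+1}`. -/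
def pBdry {n : ℕ} (γ : ℝ) (S : Set (Pt n)) : Set (Pt n) :=
  {p ∈ frontier S | ∀ r : ℝ, 0 < r → (Qcyl γ r p.1 p.2 ∩ Sᶜ).Nonempty}

end DPP

open DPP

namespace DPP

theorem aux_rpow_ext (q s0 : ℝ) (hs : 0 < s0) :
    ∃ G : ℝ → ℝ, ContDiff ℝ 2 G ∧ G =ᶠ[𝓝 s0] fun s => s ^ q := by
  let χ : ContDiffBump s0 := ⟨s0 / 4, s0 / 2, by positivity, by linarith⟩
  refine ⟨fun s => χ s * s ^ q, ?_, ?_⟩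
  · rw [contDiff_iff_contDiffAt]
    intro s
    rcases lt_or_ge 0 s with h | h
    · exact χ.contDiffAt.mul (contDiffAt_id.rpow_const_of_ne h.ne')
    · have : (fun s => χ s * s ^ q) =ᶠ[𝓝 s] fun _ => (0 : ℝ) := by
        have hlt : ∀ᶠ r in 𝓝 s, r < s0 / 2 := eventually_lt_nhds (by linarith)
        filter_upwards [hlt] with r hr
        have : χ r = 0 := by
          apply χ.zero_of_le_dist
          rw [Real.dist_eq, abs_of_neg (by linarith)]
          change s0 / 2 ≤ _
          linarith
        simp [this]
      exact contDiffAt_const.congr_of_eventuallyEq this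
  · filter_upwards [χ.eventuallyEq_one] with s h
    simp [h]

theorem aux_deriv2 (q s0 a b d : ℝ) (hs : 0 < s0) (G : ℝ → ℝ)
    (hG : G =ᶠ[𝓝 s0] fun s => s ^ q) (hG2 : ContDiff ℝ 2 G) :
    deriv (deriv (fun s => b * s - a * G s - d * s ^ 2)) s0
      = - (a * (q * (q - 1) * s0 ^ (q - 2)) + 2 * d) := by
  have h1 : (fun s => b * s - a * G s - d * s ^ 2) =ᶠ[𝓝 s0]
      fun s => b * s - a * s ^ q - d * s ^ 2 := by
    filter_upwards [hG] with s h
    rw [h]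
  rw [h1.deriv.deriv_eq]
  have h2 : deriv (fun s => b * s - a * s ^ q - d * s ^ 2) =ᶠ[𝓝 s0]
      fun s => b - a * (q * s ^ (q - 1)) - d * (2 * s) := by
    filter_upwards [eventually_gt_nhds hs] with s h
    have := (((hasDerivAt_id s).const_mul b).sub
      ((Real.hasDerivAt_rpow_const (p := q) (Or.inl h.ne')).const_mul a)).sub
      (((hasDerivAt_id s).pow 2).const_mul d)
    refine (this.congr_deriv ?_).deriv
    simp
  rw [h2.deriv_eq]
  have := (((hasDerivAt_const s0 b)).sub
      (((Real.hasDerivAt_rpow_const (p := q - 1) (Or.inl hs.ne')).const_mul q).const_mul a)).sub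
      (((hasDerivAt_id s0).const_mul 2).const_mul d)
  refine (this.congr_deriv ?_).deriv
  rw [show q - 1 - 1 = q - 2 by ring]
  ring

theorem aux_hess {n : ℕ} [NeZero n] (G : ℝ → ℝ) (hG : ContDiff ℝ 2 G) (c : ℝ) (h : ℝ → ℝ)
    (p : Pt n) (i j : Fin n) :
    hess (fun p : Pt n => G (xlast p.1) + c * ∑ i, p.1 i ^ 2 + h p.2) p i j
      = (if i = lastIdx n ∧ j = lastIdx n then deriv (deriv G) (xlast p.1) else 0)
        + if i = j then 2 * c else 0 := by
  have hd : Differentiable ℝ G := hG.differentiable (by norm_num)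
  have hd' : Differentiable ℝ (deriv G) := by
    have : ContDiff ℝ (1 + 1) G := by simpa [one_add_one_eq_two] using hG
    exact (contDiff_succ_iff_deriv.1 this).2.2.differentiable (by norm_num)
  have e1 : ∀ y : Fin n → ℝ, fderiv ℝ (fun y : Fin n → ℝ =>
      G (xlast y) + c * ∑ i, y i ^ 2 + h p.2) y (Pi.single j 1)
      = (if j = lastIdx n then deriv G (xlast y) else 0) + 2 * c * y j := by
    intro y
    have hp : ∀ k, HasFDerivAt (fun y : Fin n → ℝ => y k)
      (ContinuousLinearMap.proj (R := ℝ) (φ := fun _ : Fin n => ℝ) k) y := fun k =>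
        (ContinuousLinearMap.proj (R := ℝ) (φ := fun _ : Fin n => ℝ) k).hasFDerivAt
    have := ((((hd (xlast y)).hasDerivAt.comp_hasFDerivAt y (hp (lastIdx n))).add
      ((HasFDerivAt.fun_sum (u := Finset.univ) fun k _ => (hp k).pow 2).const_mul c)).add_const
        (h p.2)).fderiv
    have h2 := congrArg (fun L : (Fin n → ℝ) →L[ℝ] ℝ => L (Pi.single j 1)) this
    refine h2.trans ?_
    simp [Pi.single_apply, eq_comm, ContinuousLinearMap.sum_apply]
    ring
  have e2 : hess (fun p : Pt n => G (xlast p.1) + c * ∑ i, p.1 i ^ 2 + h p.2) p i j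
    = fderiv ℝ (fun y : Fin n → ℝ => (if j = lastIdx n then deriv G (xlast y) else 0)
        + 2 * c * y j) p.1 (Pi.single i 1) := by
    unfold hess
    simp only [e1]
  rw [e2]
  have hp : ∀ k, HasFDerivAt (fun y : Fin n → ℝ => y k)
      (ContinuousLinearMap.proj (R := ℝ) (φ := fun _ : Fin n => ℝ) k) p.1 := fun k =>
        (ContinuousLinearMap.proj (R := ℝ) (φ := fun _ : Fin n => ℝ) k).hasFDerivAt
  by_cases hj : j = lastIdx n
  · simp only [hj, if_true]
    have := (((hd' (xlast p.1)).hasDerivAt.comp_hasFDerivAt p.1 (hp (lastIdx n))).add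
      ((hp (lastIdx n)).const_mul (2 * c))).fderiv
    have h2 := congrArg (fun L : (Fin n → ℝ) →L[ℝ] ℝ => L (Pi.single i 1)) this
    refine h2.trans ?_
    simp [Pi.single_apply, eq_comm]
  · simp only [hj, if_false, and_false]
    have := ((hasFDerivAt_const (0:ℝ) p.1).add ((hp j).const_mul (2 * c))).fderiv
    have h2 := congrArg (fun L : (Fin n → ℝ) →L[ℝ] ℝ => L (Pi.single i 1)) this
    refine h2.trans ?_
    simp [Pi.single_apply, eq_comm]

theorem aux_pucci {n : ℕ} [NeZero n] (lam Lam g c : ℝ) (hlam : 0 < lam) (hl : lam ≤ Lam)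
    (hg : 0 ≤ g) (hc : 0 ≤ c) (H : Matrix (Fin n) (Fin n) ℝ)
    (hH : ∀ i j, H i j = (if i = lastIdx n ∧ j = lastIdx n then -g else 0)
        + if i = j then 2 * c else 0) :
    pucciPlus lam Lam H ≤ 2 * c * (n * Lam) - lam * g := by
  unfold pucciPlus
  apply csSup_le
  · refine Set.Nonempty.image _ ⟨lam • (1 : Matrix (Fin n) (Fin n) ℝ), ?_, ?_⟩
    · simp [Matrix.IsSymm]
    · intro v
      have : ∑ i, ∑ j, (lam • (1 : Matrix (Fin n) (Fin n) ℝ)) i j * v i * v j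
          = lam * ∑ i, v i ^ 2 := by
        rw [Finset.mul_sum]
        refine Finset.sum_congr rfl fun i _ => ?_
        simp [Matrix.one_apply]
        ring
      rw [this]
      exact ⟨le_rfl, mul_le_mul_of_nonneg_right hl (Finset.sum_nonneg fun i _ => sq_nonneg _)⟩
  · rintro _ ⟨A, ⟨_, hA⟩, rfl⟩
    have hd : ∀ k, lam ≤ A k k ∧ A k k ≤ Lam := by
      intro k
      have := hA (Pi.single k 1)
      simpa [Pi.single_apply, ite_pow] using this
    have htr : (A * H).trace = - g * A (lastIdx n) (lastIdx n) + 2 * c * ∑ i, A i i := by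
      have : ∀ i j, A i j * H j i = (if j = lastIdx n then (if i = lastIdx n then
          - g * A i j else 0) else 0) + if j = i then 2 * c * A i j else 0 := by
        intro i j
        rw [hH]
        split_ifs <;> simp_all <;> ring
      simp only [Matrix.trace, Matrix.diag, Matrix.mul_apply, this, Finset.sum_add_distrib]
      simp [Finset.mul_sum]
    have hs : ∑ i, A i i ≤ n * Lam := by
      calc ∑ i, A i i ≤ ∑ i : Fin n, Lam := Finset.sum_le_sum fun i _ => (hd i).2
        _ = n * Lam := by simp
    change (A * H).trace ≤ _
    rw [htr]
    have h1 := mul_le_mul_of_nonneg_left hs (by positivity : 0 ≤ 2 * c)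
    have h2 := mul_le_mul_of_nonneg_left (hd (lastIdx n)).1 hg
    linarith

theorem aux_continuous_eucNorm {n : ℕ} : Continuous (eucNorm (n := n)) := by
  unfold eucNorm
  fun_prop

theorem aux_closure {n : ℕ} [NeZero n] (γ r : ℝ) (p : Pt n)
    (hp : p ∈ closure (Qp γ r (0 : Fin n → ℝ) 0)) :
    eucNorm p.1 ≤ r ∧ - r ^ (2 - γ) ≤ p.2 ∧ p.2 ≤ 0 ∧ 0 ≤ xlast p.1 := by
  have hcl : IsClosed {p : Pt n | eucNorm p.1 ≤ r ∧ - r ^ (2 - γ) ≤ p.2 ∧ p.2 ≤ 0 ∧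
      0 ≤ xlast p.1} := by
    have h1 : Continuous fun p : Pt n => eucNorm p.1 :=
      aux_continuous_eucNorm.comp continuous_fst
    have h2 : Continuous fun p : Pt n => xlast p.1 := by unfold xlast; fun_prop
    refine (isClosed_le h1 continuous_const).inter
      ((isClosed_le continuous_const continuous_snd).inter
        ((isClosed_le continuous_snd continuous_const).inter (isClosed_le continuous_const h2)))
  refine closure_minimal ?_ hcl hp
  rintro q ⟨⟨h1, h2, h3⟩, h4⟩
  simp only [sub_zero, zero_sub] at h1 h2
  exact ⟨h1.le, h2.le, h3, h4.le⟩

theorem aux_coord {n : ℕ} (x : Fin n → ℝ) (i : Fin n) : |x i| ≤ eucNorm x := by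
  unfold eucNorm
  rw [← Real.sqrt_sq_eq_abs]
  exact Real.sqrt_le_sqrt
    (Finset.single_le_sum (f := fun i => x i ^ 2) (fun i _ => sq_nonneg _) (Finset.mem_univ i))

theorem aux_eucsq {n : ℕ} (x : Fin n → ℝ) : ∑ i, x i ^ 2 = eucNorm x ^ 2 := by
  unfold eucNorm
  rw [Real.sq_sqrt (Finset.sum_nonneg fun i _ => sq_nonneg _)]

theorem aux_compact {n : ℕ} [NeZero n] (γ : ℝ) : IsCompact (closure (Q1p n γ)) := by
  have hK : IsCompact (Set.Icc (fun _ => -1 : Fin n → ℝ) (fun _ => 1) ×ˢ Set.Icc (-1 : ℝ) 0) :=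
    isCompact_Icc.prod isCompact_Icc
  refine hK.of_isClosed_subset isClosed_closure ?_
  intro p hp
  obtain ⟨h1, h2, h3, _⟩ := aux_closure γ 1 p hp
  rw [Real.one_rpow] at h2
  exact ⟨⟨fun i => (abs_le.1 ((aux_coord p.1 i).trans h1)).1,
    fun i => (abs_le.1 ((aux_coord p.1 i).trans h1)).2⟩, h2, h3⟩

set_option maxHeartbeats 1600000 in
theorem aux_core (n : ℕ) [NeZero n] (γ lam Lam : ℝ)
    (hγ : γ < 1) (hlam : 0 < lam) (hlamLam : lam ≤ Lam) (A D : ℝ)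
    (hA : lam * (A * ((2 - γ) * (1 - γ))) = 10) (hA0 : 0 < A) (hD : D * lam = 4 * (n * Lam))
    (hD0 : 0 ≤ D)
    (u : Pt n → ℝ) (F M : ℝ) (hM : 0 < M) (hF : F ≤ M)
    (hu : ContinuousOn u (closure (Q1p n γ)))
    (huM : ∀ p ∈ closure (Q1p n γ), u p ≤ M)
    (hsub : ViscSub γ (fun M _ => pucciPlus lam Lam M) (fun _ => F) u (Q1p n γ))
    (hflat : ∀ p ∈ flatQ1p n γ, u p = 0)
    (p0 : Pt n) (hp0 : p0 ∈ closure (Qp γ (1/2) (0 : Fin n → ℝ) 0)) :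
    u p0 ≤ (A + D + 4) * M * eucNorm p0.1 := by
  obtain ⟨k1, k2, k3, k4⟩ := aux_closure γ _ p0 hp0
  have ht0 : -(1/2) ≤ p0.2 := by
    have : ((1:ℝ)/2) ^ (2 - γ) ≤ (1/2) ^ (1:ℝ) :=
      Real.rpow_le_rpow_of_exponent_ge (by norm_num) (by norm_num) (by linarith)
    rw [Real.rpow_one] at this
    linarith
  set t0 := p0.2 with ht0def
  let q : ℝ := 2 - γ
  have hq : 1 < q := by simp only [q]; linarith
  have hrp : ∀ s : ℝ, 0 ≤ s → s ≤ 1 → s ^ q ≤ s := by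
    intro s h0 h1
    have := Real.rpow_le_rpow_of_exponent_ge' h0 h1 zero_le_one hq.le
    rwa [Real.rpow_one] at this
  let ψ : ℝ → ℝ := fun s => M * (A + D) * s - M * A * s ^ q - M * D * s ^ 2
  let φ : Pt n → ℝ := fun p => ψ (xlast p.1) + 4 * M * ∑ i, p.1 i ^ 2 + 4 * M * (p.2 - t0) ^ 2
  have hψ0 : ∀ s, 0 ≤ s → s ≤ 1 → 0 ≤ ψ s := by
    intro s h0 h1
    have e1 := hrp s h0 h1
    have e2 : s ^ 2 ≤ s := by nlinarith
    have e3 := mul_le_mul_of_nonneg_left e1 (mul_pos hM hA0).le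
    have e4 := mul_le_mul_of_nonneg_left e2 (mul_nonneg hM.le hD0)
    simp only [ψ]
    nlinarith
  have hxl : Continuous fun p : Pt n => xlast p.1 := by unfold xlast; fun_prop
  have hφc : Continuous φ := by
    have h1 : Continuous fun p : Pt n => (xlast p.1) ^ q :=
      hxl.rpow_const fun _ => Or.inr (by linarith)
    simp only [φ, ψ]
    fun_prop
  have hsubset : closure (Qp γ (1/2) (0 : Fin n → ℝ) 0) ⊆ closure (Q1p n γ) := by
    apply closure_mono
    rintro p ⟨⟨h1, h2, h3⟩, h4⟩
    refine ⟨⟨h1.trans (by norm_num), lt_of_le_of_lt ?_ h2, h3⟩, h4⟩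
    have : ((1:ℝ)/2) ^ (2 - γ) ≤ 1 ^ (2 - γ) :=
      Real.rpow_le_rpow (by norm_num) (by norm_num) (by linarith)
    linarith
  obtain ⟨p, hp, hmax⟩ := (aux_compact (n := n) γ).exists_isMaxOn ⟨p0, hsubset hp0⟩
    (hu.sub hφc.continuousOn)
  have hmax' : ∀ q ∈ closure (Q1p n γ), u q - φ q ≤ u p - φ p := fun q hq => hmax hq
  have key : u p - φ p ≤ 0 := by
    by_contra hpos
    push Not at hpos
    obtain ⟨a1, a2, a3, a4⟩ := aux_closure γ 1 p hp
    rw [Real.one_rpow] at a2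
    have hs1 : xlast p.1 ≤ 1 := (le_abs_self _).trans ((aux_coord p.1 _).trans a1)
    have hψp := hψ0 _ a4 hs1
    have hsum0 : 0 ≤ ∑ i, p.1 i ^ 2 := Finset.sum_nonneg fun i _ => sq_nonneg _
    have hφp : φ p = ψ (xlast p.1) + 4 * M * ∑ i, p.1 i ^ 2 + 4 * M * (p.2 - t0) ^ 2 := rfl
    have huMp := huM p hp
    have m1 : 0 ≤ 4 * M * ∑ i, p.1 i ^ 2 := by positivity
    have m2 : 0 ≤ 4 * M * (p.2 - t0) ^ 2 := by positivity
    have b1 : eucNorm p.1 < 1 := by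
      refine lt_of_le_of_ne a1 fun h => ?_
      rw [aux_eucsq, h] at hφp
      linarith
    have b2 : -1 < p.2 := by
      refine lt_of_le_of_ne a2 fun h => ?_
      have : 1/4 ≤ (p.2 - t0) ^ 2 := by rw [← h]; nlinarith
      have := mul_le_mul_of_nonneg_left this (by positivity : 0 ≤ 4 * M)
      linarith
    have b3 : 0 < xlast p.1 := by
      refine lt_of_le_of_ne a4 fun h => ?_
      have hf : p ∈ flatQ1p n γ := ⟨⟨hp, fun hQ => hQ.2.ne h⟩, h.symm⟩
      rw [hflat p hf] at hpos
      linarith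
    have hpQ : p ∈ Q1p n γ := by
      refine ⟨⟨by simpa using b1, by simpa using b2, a3⟩, b3⟩
    obtain ⟨G, hG2, hG⟩ := aux_rpow_ext q (xlast p.1) b3
    let g : ℝ → ℝ := fun s => M * (A + D) * s - M * A * G s - M * D * s ^ 2
    have hg2 : ContDiff ℝ 2 g := by simp only [g]; fun_prop
    let h : ℝ → ℝ := fun t => 4 * M * (t - t0) ^ 2 + (u p - φ p)
    let Φ : Pt n → ℝ := fun p => g (xlast p.1) + 4 * M * ∑ i, p.1 i ^ 2 + h p.2
    have hev : ∀ᶠ x in 𝓝 p, Φ x = φ x + (u p - φ p) := by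
      filter_upwards [hxl.continuousAt.eventually hG] with x hx
      simp only [Φ, φ, g, ψ, h] at hx ⊢
      rw [hx]; ring
    have htest : IsTestFn Φ := by
      have hgc := hg2.continuous
      refine ⟨?_, fun x => ?_, fun t => ?_⟩
      · simp only [Φ, h]; fun_prop
      · simp only [Φ, h]; fun_prop
      · simp only [Φ, xlast]; fun_prop
    have htouch : TouchAbove u Φ (Q1p n γ) p := by
      refine ⟨by rw [hev.self_of_nhds]; ring, ?_⟩
      filter_upwards [nhdsWithin_le_nhds hev, self_mem_nhdsWithin] with x hx hxQ
      rw [hx]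
      have := hmax' x (subset_closure hxQ)
      linarith
    have hv := hsub p hpQ Φ htest htouch
    have htd : timeD Φ p = 8 * M * (p.2 - t0) := by
      have : HasDerivAt (fun s => Φ (p.1, s)) (8 * M * (p.2 - t0)) p.2 := by
        have := (((((hasDerivAt_id p.2).sub_const t0).pow 2).const_mul (4 * M)).add_const
          (u p - φ p)).const_add (g (xlast p.1) + 4 * M * ∑ i, p.1 i ^ 2)
        refine this.congr_deriv ?_
        simp; ring
      exact this.deriv
    set s := xlast p.1 with hsdef
    let gg : ℝ := M * A * (q * (q - 1) * s ^ (q - 2)) + 2 * (M * D)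
    have hsp : 0 < s ^ (q - 2) := Real.rpow_pos_of_pos b3 _
    have hgg : 0 ≤ gg := by
      have : 0 < q - 1 := by linarith
      have : 0 < q := by linarith
      simp only [gg]; positivity
    have hpu : pucciPlus lam Lam (hess Φ p) ≤ 2 * (4 * M) * (n * Lam) - lam * gg := by
      refine aux_pucci lam Lam gg (4 * M) hlam hlamLam hgg (by positivity) _ fun i j => ?_
      have e := aux_hess g hg2 (4 * M) h p i j
      rw [aux_deriv2 q s (M * A) (M * (A + D)) (M * D) b3 G hG hG2] at e
      exact e
    have hsg : 0 < s ^ γ := Real.rpow_pos_of_pos b3 _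
    have hss : s ^ γ * s ^ (q - 2) = 1 := by
      rw [← Real.rpow_add b3]
      simp [q]
    have hmul := mul_le_mul_of_nonneg_left hpu hsg.le
    have hqq : lam * (A * (q * (q - 1))) = 10 := by
      rw [← hA]; simp only [q]; ring
    have hR : s ^ γ * (2 * (4 * M) * (n * Lam) - lam * gg) = - 10 * M := by
      calc _ = s ^ γ * (2 * M) * (4 * (n * Lam) - D * lam)
            - M * (lam * (A * (q * (q - 1)))) * (s ^ γ * s ^ (q - 2)) := by
              simp only [gg]; ring
        _ = _ := by rw [hqq, hss, hD]; ring
    have hv' : timeD Φ p - s ^ γ * pucciPlus lam Lam (hess Φ p) ≤ F := hv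
    rw [htd] at hv'
    have hlow : 0 ≤ 8 * M * (p.2 - t0 + 1) := mul_nonneg (by positivity) (by linarith)
    linarith
  have hfin := hmax' p0 (hsubset hp0)
  have he0 : 0 ≤ eucNorm p0.1 := Real.sqrt_nonneg _
  have hsx : xlast p0.1 ≤ eucNorm p0.1 := (le_abs_self _).trans (aux_coord p0.1 _)
  have hφ0 : φ p0 ≤ (A + D + 4) * M * eucNorm p0.1 := by
    have e : φ p0 = ψ (xlast p0.1) + 4 * M * eucNorm p0.1 ^ 2 := by
      simp only [φ, aux_eucsq, ← ht0def]; ring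
    have e1 : ψ (xlast p0.1) ≤ M * (A + D) * xlast p0.1 := by
      have : 0 ≤ M * A * xlast p0.1 ^ q := by positivity
      have : 0 ≤ M * D * xlast p0.1 ^ 2 := by positivity
      simp only [ψ]; linarith
    have e2 : M * (A + D) * xlast p0.1 ≤ M * (A + D) * eucNorm p0.1 :=
      mul_le_mul_of_nonneg_left hsx (by positivity)
    have e3 : 4 * M * eucNorm p0.1 ^ 2 ≤ 4 * M * eucNorm p0.1 :=
      mul_le_mul_of_nonneg_left (by nlinarith) (by positivity)
    rw [e]; linarith
  linarith

theorem aux_neg {n : ℕ} [NeZero n] (γ lam Lam F : ℝ) (u : Pt n → ℝ) (Ω : Set (Pt n))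
    (hs : ViscSuper γ (fun M _ => pucciMinus lam Lam M) (fun _ => -F) u Ω) :
    ViscSub γ (fun M _ => pucciPlus lam Lam M) (fun _ => F) (fun p => - u p) Ω := by
  intro p hp φ hφ ht
  have h := hs p hp (fun q => - φ q) ⟨hφ.1.neg, fun x => (hφ.2.1 x).neg, fun t => (hφ.2.2 t).neg⟩
    ⟨by have := ht.1; simp only at this; linarith, by
      filter_upwards [ht.2] with q hq; linarith⟩
  have h1 : timeD (fun q => - φ q) p = - timeD φ p := by
    simp [timeD]
  have h2 : hess (fun q => - φ q) p = - hess φ p := by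
    ext i j
    simp [hess]
  have h3 : pucciMinus lam Lam (- hess φ p) = - pucciPlus lam Lam (hess φ p) := by
    unfold pucciMinus pucciPlus
    rw [← Real.sInf_neg]
    congr 1
    ext y
    simp [neg_eq_iff_eq_neg, Set.mem_neg]
  simp only [h1, h2, h3] at h
  simp only
  linarith

end DPP

/-- **Lipschitz estimate at the flat boundary** (Lemma 3.1). -/
theorem lipschitz_estimate_flat_boundary
    (n : ℕ) [NeZero n] (hn : 2 ≤ n) (γ lam Lam : ℝ)
    (hγ : γ < 1) (hlam : 0 < lam) (hlamLam : lam ≤ Lam) :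
    ∃ C : ℝ, 0 < C ∧
      ∀ f u : Pt n → ℝ,
        ContinuousOn f (Q1p n γ) →
        BddAbove ((fun p => |f p|) '' Q1p n γ) →
        ContinuousOn u (closure (Q1p n γ)) →
        InSstar γ lam Lam f u (Q1p n γ) →
        (∀ p ∈ flatQ1p n γ, u p = 0) →
        ∀ p ∈ closure (Qp γ (1/2) (0 : Fin n → ℝ) 0),
          |u p| ≤ C * (supAbs u (Q1p n γ) + supAbs f (Q1p n γ)) * eucNorm p.1 := by
  have hn0 : (0:ℝ) < n := by exact_mod_cast (by omega : 0 < n)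
  have hLam : 0 < Lam := hlam.trans_le hlamLam
  have hγ1 : 0 < 1 - γ := by linarith
  have hγ2 : 0 < 2 - γ := by linarith
  obtain ⟨A, hA⟩ : ∃ A : ℝ, A = 10 / (lam * ((2 - γ) * (1 - γ))) := ⟨_, rfl⟩
  obtain ⟨D, hD⟩ : ∃ D : ℝ, D = 4 * (n * Lam) / lam := ⟨_, rfl⟩
  have hA0 : 0 < A := by rw [hA]; positivity
  have hD0 : 0 < D := by rw [hD]; positivity
  have hA' : lam * (A * ((2 - γ) * (1 - γ))) = 10 := by rw [hA]; field_simp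
  have hD' : D * lam = 4 * (n * Lam) := by rw [hD]; field_simp
  refine ⟨A + D + 4, by positivity, ?_⟩
  intro f u _ _ hu hS hflat p hp
  have hbdd : BddAbove (Set.range fun p : Q1p n γ => |u ↑p|) := by
    have := (aux_compact (n := n) γ).bddAbove_image hu.abs
    refine this.mono ?_
    rintro _ ⟨q, rfl⟩
    exact ⟨q, subset_closure q.2, rfl⟩
  have huS : ∀ q ∈ closure (Q1p n γ), |u q| ≤ supAbs u (Q1p n γ) := by
    intro q hq
    refine le_on_closure (f := fun q => |u q|) (g := fun _ => supAbs u (Q1p n γ))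
      (fun r hr => ?_) hu.abs continuousOn_const hq
    exact le_ciSup hbdd (⟨r, hr⟩ : Q1p n γ)
  have hu0 : 0 ≤ supAbs u (Q1p n γ) := Real.iSup_nonneg fun _ => abs_nonneg _
  have hf0 : 0 ≤ supAbs f (Q1p n γ) := Real.iSup_nonneg fun _ => abs_nonneg _
  have he0 : 0 ≤ eucNorm p.1 := Real.sqrt_nonneg _
  have main : ∀ ε : ℝ, 0 < ε → |u p| ≤
      (A + D + 4) * (supAbs u (Q1p n γ) + supAbs f (Q1p n γ) + ε) * eucNorm p.1 := by
    intro ε hε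
    refine abs_le'.2 ⟨?_, ?_⟩
    · exact aux_core n γ lam Lam hγ hlam hlamLam A D hA' hA0 hD' hD0.le u
        (supAbs f (Q1p n γ)) _ (by positivity) (by linarith) hu
        (fun q hq => by linarith [(le_abs_self _).trans (huS q hq)]) hS.1 hflat p hp
    · exact aux_core n γ lam Lam hγ hlam hlamLam A D hA' hA0 hD' hD0.le (fun q => - u q)
        (supAbs f (Q1p n γ)) _ (by positivity) (by linarith) hu.neg
        (fun q hq => by linarith [(neg_le_abs _).trans (huS q hq)])
        (aux_neg γ lam Lam _ u _ hS.2) (fun q hq => by simp [hflat q hq]) p hp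
  have hlim : Tendsto (fun ε : ℝ => (A + D + 4) *
      (supAbs u (Q1p n γ) + supAbs f (Q1p n γ) + ε) * eucNorm p.1) (𝓝[>] 0)
      (𝓝 ((A + D + 4) * (supAbs u (Q1p n γ) + supAbs f (Q1p n γ) + 0) * eucNorm p.1)) := by
    apply Tendsto.mono_left _ nhdsWithin_le_nhds
    apply Continuous.tendsto
    fun_prop
  rw [add_zero] at hlim
  refine ge_of_tendsto hlim ?_
  filter_upwards [self_mem_nhdsWithin] with ε hε
  exact main ε hε
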